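/- Let c₀ > √(h₁ + 1) where h₁ > 0 is a constant. Suppose n, v : ℝ → ℝ are Schwartz functions solving the system −c₀ ∂_z n + ∂_z v = H₁ and −c₀ ∂_z v + ∂_z(h₁ n + (Id − ∂_z²)^{-1} n) = H₂. Then ∂_z n satisfies (b − d ∂_z²)(∂_z n) = −(1 − ∂_z²)(c₀ H₁ + H₂) where b = c₀² − h₁ − 1 > 0 and d = c₀² − h₁ > 1, and consequently for every p ∈ [1, ∞] and integer m ≥ 0, ‖∂_z(n, v)‖_{W^{m,p}} ≤ C ‖(H₁, H₂)‖_{W^{m,p}} with C depending only on b, d. -/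

import Mathlib

open MeasureTheory

noncomputable def kerM : Measure ℝ :=
  volume.withDensity (fun y => ENNReal.ofReal (1 / 2 * Real.exp (-|y|)))

noncomputable def kerK (f : ℝ → ℝ) (z : ℝ) : ℝ := ∫ y, f (z - y) ∂kerM

noncomputable abbrev dS (f : SchwartzMap ℝ ℝ) : SchwartzMap ℝ ℝ := SchwartzMap.derivCLM ℝ ℝ f

lemma ker_Ioi : IntegrableOn (fun y : ℝ => Real.exp (-|y|)) (Set.Ioi 0) := by
  refine (integrableOn_exp_neg_Ioi 0).congr_fun ?_ measurableSet_Ioi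
  intro x hx
  simp [abs_of_pos (Set.mem_Ioi.1 hx)]

lemma ker_Iic : IntegrableOn (fun y : ℝ => Real.exp (-|y|)) (Set.Iic 0) := by
  refine (integrableOn_exp_Iic 0).congr_fun ?_ measurableSet_Iic
  intro x hx
  simp [abs_of_nonpos (Set.mem_Iic.1 hx)]

lemma ker_int : Integrable (fun y : ℝ => Real.exp (-|y|)) := by
  rw [← integrableOn_univ, ← Set.Iic_union_Ioi (a := (0:ℝ))]
  exact ker_Iic.union ker_Ioi

lemma ker_total : ∫ y : ℝ, Real.exp (-|y|) = 2 := by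
  rw [integral_comp_abs (f := fun x => Real.exp (-x)), integral_exp_neg_Ioi_zero]; norm_num

instance : IsProbabilityMeasure kerM := by
  constructor
  rw [kerM, withDensity_apply _ MeasurableSet.univ, Measure.restrict_univ,
    ← ofReal_integral_eq_lintegral_ofReal (ker_int.const_mul _) (ae_of_all _ fun x => by positivity),
    integral_const_mul, ker_total]
  norm_num

lemma ker_eq (f : ℝ → ℝ) (w : ℝ) :
    (1 / 2) * ∫ z' : ℝ, Real.exp (-|w - z'|) * f z' = kerK f w := by
  rw [kerK, kerM, integral_withDensity_eq_integral_toReal_smul (by fun_prop)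
    (ae_of_all _ fun x => ENNReal.ofReal_lt_top), ← integral_const_mul,
    ← integral_sub_left_eq_self _ _ w]
  congr 1; ext y
  rw [ENNReal.toReal_ofReal (by positivity)]
  simp; ring

lemma kerK_eq (f : ℝ → ℝ) (w : ℝ) :
    kerK f w = (1 / 2) * ∫ y : ℝ, Real.exp (-|y|) * f (w - y) := by
  rw [← ker_eq, ← integral_sub_left_eq_self _ _ w]
  simp

lemma sch_bd (f : SchwartzMap ℝ ℝ) : ∃ B, ∀ x, ‖f x‖ ≤ B :=
  ⟨_, fun x => f.norm_le_seminorm ℝ x⟩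

lemma sch_hd (f : SchwartzMap ℝ ℝ) (x : ℝ) : HasDerivAt f (dS f x) x := by
  rw [SchwartzMap.derivCLM_apply]
  exact f.differentiable.differentiableAt.hasDerivAt

lemma sch_hd_sub (f : SchwartzMap ℝ ℝ) (z x : ℝ) :
    HasDerivAt (fun y => f (z - y)) (- dS f (z - x)) x := by
  have h := (sch_hd f (z - x)).comp x ((hasDerivAt_id x).const_sub z)
  rw [mul_neg_one] at h
  exact h

lemma kerK_hd (f : SchwartzMap ℝ ℝ) (z : ℝ) : HasDerivAt (kerK f) (kerK (dS f) z) z := by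
  obtain ⟨B, hB⟩ := sch_bd (dS f)
  obtain ⟨B', hB'⟩ := sch_bd f
  have hcf := f.continuous
  have hcf' := (dS f).continuous
  have := hasDerivAt_integral_of_dominated_loc_of_deriv_le (μ := kerM) (𝕜 := ℝ)
    (F := fun z y => f (z - y)) (F' := fun z y => dS f (z - y)) (x₀ := z) (s := Set.univ)
    (bound := fun _ => B) Filter.univ_mem
    (Filter.Eventually.of_forall fun x => by
      exact (Continuous.aestronglyMeasurable (by fun_prop)))
    (Integrable.of_bound (Continuous.aestronglyMeasurable (by fun_prop)) B'
      (ae_of_all _ fun _ => hB' _))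
    (Continuous.aestronglyMeasurable (by fun_prop))
    (ae_of_all _ fun _ _ _ => hB _) (integrable_const _)
    (ae_of_all _ fun y x _ => by
      simpa using (sch_hd f (x - y)).comp_sub_const x y)
  exact this.2

lemma ker_mul_int (f : SchwartzMap ℝ ℝ) (z : ℝ) :
    Integrable (fun y : ℝ => Real.exp (-|y|) * f (z - y)) := by
  obtain ⟨B, hB⟩ := sch_bd f
  have := f.continuous
  exact ker_int.mul_bdd (c := B) (Continuous.aestronglyMeasurable (by fun_prop)) (ae_of_all _ fun _ => hB _)

lemma kerK_dd (f : SchwartzMap ℝ ℝ) (z : ℝ) : kerK (dS (dS f)) z = kerK f z - f z := by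
  obtain ⟨B, hB⟩ := sch_bd f
  obtain ⟨B', hB'⟩ := sch_bd (dS f)
  have hint := (ker_mul_int (dS (dS f)) z).sub (ker_mul_int f z)
  have h1 : ∫ y in Set.Ioi (0:ℝ), (Real.exp (-|y|) * dS (dS f) (z - y) - Real.exp (-|y|) * f (z - y))
      = 0 - (-(Real.exp (-0) * (dS f (z - 0) - f (z - 0)))) := by
    have hint' : IntegrableOn (fun y : ℝ => (Real.exp (-y) * dS (dS f) (z - y) - Real.exp (-y) * f (z - y))) (Set.Ioi 0) := by
      refine hint.integrableOn.congr_fun ?_ measurableSet_Ioi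
      intro y hy
      simp [abs_of_pos (Set.mem_Ioi.1 hy)]
    rw [← integral_Ioi_of_hasDerivAt_of_tendsto' (f := fun y => (-(Real.exp (-y) * (dS f (z - y) - f (z - y))))) _ hint']
    · refine setIntegral_congr_fun measurableSet_Ioi ?_
      intro y hy
      simp [abs_of_pos (Set.mem_Ioi.1 hy)]
    · rw [← neg_zero]
      refine Filter.Tendsto.neg ?_
      refine Filter.Tendsto.zero_mul_isBoundedUnder_le (Real.tendsto_exp_neg_atTop_nhds_zero) ?_
      refine Filter.isBoundedUnder_of ⟨B' + B, fun y => ?_⟩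
      exact (norm_sub_le _ _).trans (add_le_add (hB' _) (hB _))
    · intro x _
      have := ((Real.hasDerivAt_exp (-x)).comp x (hasDerivAt_neg x)).mul
        ((sch_hd_sub (dS f) z x).sub (sch_hd_sub f z x))
      convert! this.neg using 1
      simp only [Function.comp, Pi.sub_apply]; ring
  have h2 : ∫ y in Set.Iic (0:ℝ), (Real.exp (-|y|) * dS (dS f) (z - y) - Real.exp (-|y|) * f (z - y))
      = (-(Real.exp 0 * (dS f (z - 0) + f (z - 0)))) - 0 := by
    have hint' : IntegrableOn (fun y : ℝ => (Real.exp y * dS (dS f) (z - y) - Real.exp y * f (z - y))) (Set.Iic 0) := by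
      refine hint.integrableOn.congr_fun ?_ measurableSet_Iic
      intro y hy
      simp [abs_of_nonpos (Set.mem_Iic.1 hy)]
    rw [← integral_Iic_of_hasDerivAt_of_tendsto' (f := fun y => (-(Real.exp y * (dS f (z - y) + f (z - y))))) _ hint']
    · refine setIntegral_congr_fun measurableSet_Iic ?_
      intro y hy
      simp [abs_of_nonpos (Set.mem_Iic.1 hy)]
    · rw [← neg_zero]
      refine Filter.Tendsto.neg ?_
      refine Filter.Tendsto.zero_mul_isBoundedUnder_le (Real.tendsto_exp_atBot) ?_
      refine Filter.isBoundedUnder_of ⟨B' + B, fun y => ?_⟩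
      exact (norm_add_le _ _).trans (add_le_add (hB' _) (hB _))
    · intro x _
      have := (Real.hasDerivAt_exp x).mul
        ((sch_hd_sub (dS f) z x).add (sch_hd_sub f z x))
      convert! this.neg using 1
      simp only [Pi.add_apply]; ring
  have h3 := intervalIntegral.integral_Iic_add_Ioi (b := (0:ℝ)) hint.integrableOn hint.integrableOn
  simp only [Pi.sub_apply] at h3
  rw [h1, h2, integral_sub (ker_mul_int (dS (dS f)) z) (ker_mul_int f z)] at h3
  rw [kerK_eq, kerK_eq]
  simp only [sub_zero, neg_zero, Real.exp_zero, one_mul] at h3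
  linarith

lemma kerK_norm (f : SchwartzMap ℝ ℝ) (p : ENNReal) (hp : 1 ≤ p) :
    eLpNorm (kerK f) p volume ≤ eLpNorm f p volume := by
  have hcf := f.continuous
  have key : ∀ z, ‖kerK f z‖ₑ ≤ eLpNorm (fun y => f (z - y)) p kerM := by
    intro z
    refine (enorm_integral_le_lintegral_enorm _).trans ?_
    rw [← eLpNorm_one_eq_lintegral_enorm]
    exact eLpNorm_le_eLpNorm_of_exponent_le hp (Continuous.aestronglyMeasurable (by fun_prop))
  by_cases hpt : p = ⊤
  · subst hpt
    rw [eLpNorm_exponent_top]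
    refine eLpNormEssSup_le_of_ae_enorm_bound (ae_of_all _ fun z => (key z).trans ?_)
    rw [eLpNorm_exponent_top]
    refine (eLpNormEssSup_mono_measure _ (withDensity_absolutelyContinuous _ _)).trans ?_
    rw [← eLpNorm_exponent_top]
    exact (eLpNorm_comp_measurePreserving (g := f) hcf.aestronglyMeasurable
      (Measure.measurePreserving_sub_left volume z)).le
  have hp0 : p ≠ 0 := (zero_lt_one.trans_le hp).ne'
  have hpr : 0 < p.toReal := ENNReal.toReal_pos hp0 hpt
  rw [eLpNorm_eq_lintegral_rpow_enorm_toReal hp0 hpt, eLpNorm_eq_lintegral_rpow_enorm_toReal hp0 hpt]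
  gcongr ?_ ^ _
  calc ∫⁻ z, ‖kerK f z‖ₑ ^ p.toReal ≤ ∫⁻ z, ∫⁻ y, ‖f (z - y)‖ₑ ^ p.toReal ∂kerM := by
        refine lintegral_mono fun z => ?_
        refine (ENNReal.rpow_le_rpow (key z) hpr.le).trans ?_
        rw [eLpNorm_eq_lintegral_rpow_enorm_toReal hp0 hpt, ← ENNReal.rpow_mul,
          one_div_mul_cancel hpr.ne', ENNReal.rpow_one]
    _ = ∫⁻ y, (∫⁻ z, ‖f (z - y)‖ₑ ^ p.toReal) ∂kerM := by
        refine lintegral_lintegral_swap ?_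
        refine Measurable.aemeasurable ?_
        unfold Function.uncurry
        have : Continuous fun q : ℝ × ℝ => f (q.1 - q.2) := by fun_prop
        exact this.measurable.enorm.pow_const _
    _ = ∫⁻ y, (∫⁻ z, ‖f z‖ₑ ^ p.toReal) ∂kerM := by
        refine lintegral_congr fun y => ?_
        exact lintegral_sub_right_eq_self (fun z => ‖f z‖ₑ ^ p.toReal) y
    _ = _ := by simp

lemma iter_sch (k : ℕ) (f : SchwartzMap ℝ ℝ) : iteratedDeriv k f = dS^[k] f := by
  induction k generalizing f with
  | zero => simp
  | succ k ih =>
    rw [iteratedDeriv_succ', Function.iterate_succ_apply, ← ih]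
    rfl

lemma iter_comb (k : ℕ) (a b c : ℝ) (f g h : SchwartzMap ℝ ℝ) :
    iteratedDeriv k (fun z => a * f z + b * g z + c * kerK h z) =
      fun z => a * (dS^[k] f) z + b * (dS^[k] g) z + c * kerK (dS^[k] h) z := by
  induction k generalizing f g h with
  | zero => simp
  | succ k ih =>
    rw [iteratedDeriv_succ', Function.iterate_succ_apply, Function.iterate_succ_apply,
      Function.iterate_succ_apply, ← ih]
    congr 1; ext z
    exact ((((sch_hd f z).const_mul a).add ((sch_hd g z).const_mul b)).add
      ((kerK_hd h z).const_mul c)).deriv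

lemma kerK_cont (f : SchwartzMap ℝ ℝ) : Continuous (kerK f) :=
  continuous_iff_continuousAt.2 fun z => (kerK_hd f z).continuousAt

lemma est_final (b c : ℝ) (hb : 0 < b) (hc : 0 < c) (A B X Y : ENNReal) (hA : A ≠ ⊤)
    (h1 : ENNReal.ofReal (b + 1) * A ≤ A + (ENNReal.ofReal c * X + Y))
    (h2 : B ≤ X + ENNReal.ofReal c * A) :
    A + B ≤ ENNReal.ofReal (1 + (1 + c) ^ 2 / b) * (X + Y) := by
  have hC : 0 < 1 + (1 + c) ^ 2 / b := by positivity
  by_cases hX : X = ⊤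
  · subst hX; simp [ENNReal.mul_top, hC]
  by_cases hY : Y = ⊤
  · subst hY; simp [ENNReal.mul_top, hC]
  have hB : B ≠ ⊤ := ne_top_of_le_ne_top (by finiteness) h2
  lift A to NNReal using hA
  lift B to NNReal using hB
  lift X to NNReal using hX
  lift Y to NNReal using hY
  rw [← ENNReal.toReal_le_toReal (by finiteness) (by finiteness)] at h1 h2 ⊢
  simp only [ENNReal.toReal_add, ENNReal.toReal_mul, ne_eq, ENNReal.coe_ne_top, not_false_eq_true,
    ENNReal.mul_ne_top, ENNReal.ofReal_ne_top, ENNReal.add_ne_top, ENNReal.coe_toReal, and_self,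
    ENNReal.toReal_ofReal hC.le, ENNReal.toReal_ofReal hc.le,
    ENNReal.toReal_ofReal (by positivity : 0 ≤ b + 1)] at h1 h2 ⊢
  have hX := X.2
  have hY := Y.2
  have hX' : (0:ℝ) ≤ X := X.2
  have hY' : (0:ℝ) ≤ Y := Y.2
  have h3 : (A:ℝ) ≤ (c * X + Y) / b := by rw [le_div_iff₀ hb]; linarith
  calc (A:ℝ) + B ≤ X + (1 + c) * A := by linarith
    _ ≤ X + (1 + c) * ((c * X + Y) / b) := by gcongr
    _ ≤ X + (1 + c) * (((1 + c) * (X + Y)) / b) := by gcongr; nlinarith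
    _ ≤ (X + Y) + (1 + c) * (((1 + c) * (X + Y)) / b) := by linarith
    _ = _ := by ring

theorem stmt2 (h₁ c₀ : ℝ) (hh : 0 < h₁) (hc : Real.sqrt (h₁ + 1) < c₀) :
    ∃ C : ℝ, 0 < C ∧
      ∀ (n v : SchwartzMap ℝ ℝ) (H₁ H₂ : ℝ → ℝ),
        (∀ z, -c₀ * deriv (⇑n) z + deriv (⇑v) z = H₁ z) →
        (∀ z, -c₀ * deriv (⇑v) z +
            deriv (fun w => h₁ * n w + (1 / 2) * ∫ z' : ℝ, Real.exp (-|w - z'|) * n z') z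
            = H₂ z) →
        ((0 < c₀ ^ 2 - h₁ - 1 ∧ 1 < c₀ ^ 2 - h₁) ∧
          (∀ z, (c₀ ^ 2 - h₁ - 1) * deriv (⇑n) z
              - (c₀ ^ 2 - h₁) * deriv (deriv (deriv (⇑n))) z =
            -(c₀ * H₁ z + H₂ z) + deriv (deriv (fun w => c₀ * H₁ w + H₂ w)) z) ∧
          ∀ (p : ENNReal), 1 ≤ p → ∀ m : ℕ,
            (∑ k ∈ Finset.range (m + 1),
                (eLpNorm (iteratedDeriv k (deriv (⇑n))) p volume +
                  eLpNorm (iteratedDeriv k (deriv (⇑v))) p volume)) ≤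
              ENNReal.ofReal C *
                ∑ k ∈ Finset.range (m + 1),
                  (eLpNorm (iteratedDeriv k H₁) p volume +
                    eLpNorm (iteratedDeriv k H₂) p volume)) := by
  have hc0 : 0 < c₀ := (Real.sqrt_nonneg _).trans_lt hc
  have hsq : h₁ + 1 < c₀ ^ 2 := (Real.sqrt_lt' hc0).1 hc
  have hb : 0 < c₀ ^ 2 - h₁ - 1 := by linarith
  refine ⟨1 + (1 + c₀) ^ 2 / (c₀ ^ 2 - h₁ - 1), by positivity, ?_⟩
  intro n v H₁ H₂ e1 e2
  have dn : deriv (⇑n) = dS n := rfl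
  have dv : deriv (⇑v) = dS v := rfl
  have E1 : H₁ = fun z => (-c₀) * dS n z + 1 * dS v z + 0 * kerK (dS n) z := by
    ext z; rw [← e1, dn, dv]; ring
  have E2 : H₂ = fun z => (-c₀) * dS v z + h₁ * dS n z + 1 * kerK (dS n) z := by
    ext z
    rw [← e2]
    simp only [ker_eq]
    have hd : deriv (fun w => h₁ * n w + kerK n w) z = h₁ * dS n z + kerK (dS n) z :=
      (((sch_hd n z).const_mul h₁).add (kerK_hd n z)).deriv
    rw [hd, dv]; ring
  refine ⟨⟨hb, by linarith⟩, ?_, ?_⟩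
  · intro z
    have E3 : (fun w => c₀ * H₁ w + H₂ w) = fun w =>
        (-c₀^2) * dS n w + h₁ * dS n w + 1 * kerK (dS n) w := by
      ext w; rw [E1, E2]; ring
    have E4 := congrFun (iter_comb 2 (-c₀^2) h₁ 1 (dS n) (dS n) (dS n)) z
    rw [← E3, iteratedDeriv_succ, iteratedDeriv_one] at E4
    have E5 : c₀ * H₁ z + H₂ z = _ := congrFun E3 z
    have E6 : deriv (deriv (deriv (⇑n))) z = dS (dS (dS n)) z := rfl
    rw [E4, E5, E6, dn]
    simp only [Function.iterate_succ_apply, Function.iterate_zero_apply]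
    rw [kerK_dd]; ring
  · intro p hp m
    rw [Finset.mul_sum]
    refine Finset.sum_le_sum fun k _ => ?_
    rw [dn, dv, iter_sch, iter_sch]
    have I1 := iter_comb k (-c₀) 1 0 (dS n) (dS v) (dS n)
    rw [← E1] at I1
    have I2 := iter_comb k (-c₀) h₁ 1 (dS v) (dS n) (dS n)
    rw [← E2] at I2
    generalize dS^[k] (dS n) = N at *
    generalize dS^[k] (dS v) = V at *
    have hN := N.continuous
    have hV := V.continuous
    have hK := kerK_cont N
    have c1 : Continuous (iteratedDeriv k H₁) := by rw [I1]; fun_prop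
    have c2 : Continuous (iteratedDeriv k H₂) := by rw [I2]; fun_prop
    have cm : ∀ (a : ℝ) (f : ℝ → ℝ), 0 < a →
        eLpNorm (a • f) p volume = ENNReal.ofReal a * eLpNorm f p volume := by
      intro a f ha
      rw [eLpNorm_const_smul, Real.enorm_eq_ofReal ha.le]
    have hfin : eLpNorm (⇑N) p volume ≠ ⊤ := (N.memLp p volume).eLpNorm_ne_top
    refine est_final _ _ hb hc0 _ _ _ _ hfin ?_ ?_
    · rw [← cm (c₀ ^ 2 - h₁ - 1 + 1) (⇑N) (by linarith), ← cm c₀ (iteratedDeriv k H₁) hc0]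
      have : (c₀ ^ 2 - h₁ - 1 + 1) • (⇑N) =
          kerK N - (c₀ • iteratedDeriv k H₁ + iteratedDeriv k H₂) := by
        ext z
        simp only [I1, I2, Pi.smul_apply, Pi.sub_apply, Pi.add_apply, smul_eq_mul]; ring
      rw [this]
      refine (eLpNorm_sub_le hK.aestronglyMeasurable
        ((c1.const_smul c₀).add c2).aestronglyMeasurable hp).trans ?_
      exact add_le_add (kerK_norm N p hp) (eLpNorm_add_le
        (c1.const_smul c₀).aestronglyMeasurable c2.aestronglyMeasurable hp)
    · rw [← cm c₀ (⇑N) hc0]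
      have : (⇑V) = iteratedDeriv k H₁ + c₀ • (⇑N) := by
        ext z
        simp only [I1, Pi.smul_apply, Pi.add_apply, smul_eq_mul]; ring
      rw [this]
      exact eLpNorm_add_le c1.aestronglyMeasurable (hN.const_smul c₀).aestronglyMeasurable hp
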